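/- arXiv:1609.02380 — 4 statements merged into one kernel-verified Lean document; each statement's English description precedes it below -/
import Mathlib

section
/- Let G be a finite group and N a subnormal subgroup of G. Then O_𝒫(N) = N ∩ O_𝒫(G). -/
open Pointwise

namespace PaperPF
set_option linter.unusedVariables false

/-- A subgroup `K` is subnormal if there is a finite chain
`K = K₀ ⊴ K₁ ⊴ ⋯ ⊴ Kₙ = G` with each term normal in the next. -/
def IsSubnormal {G : Type} [Group G] (K : Subgroup G) : Prop :=
  ∃ (n : ℕ) (c : Fin (n + 1) → Subgroup G),
    c 0 = K ∧ c (Fin.last n) = ⊤ ∧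
      ∀ i : Fin n, c i.castSucc ≤ c i.succ ∧ ((c i.castSucc).subgroupOf (c i.succ)).Normal

/-- A finite group is quasisimple if it is perfect and its central quotient is a
nonabelian simple group. -/
def IsQuasisimple (X : Type) [Group X] : Prop :=
  commutator X = ⊤ ∧ IsSimpleGroup (X ⧸ Subgroup.center X) ∧
    ∃ a b : X ⧸ Subgroup.center X, a * b ≠ b * a

/-- A component: a quasisimple subnormal subgroup. -/
def IsComponent {G : Type} [Group G] (K : Subgroup G) : Prop :=
  IsSubnormal K ∧ IsQuasisimple ↥K

/-- The subgroup generated by a family of subgroups. -/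
def genBy {G : Type} [Group G] (S : Set (Subgroup G)) : Subgroup G :=
  Subgroup.closure (⋃ N ∈ S, (N : Set G))

theorem genBy_normal {G : Type} [Group G] {S : Set (Subgroup G)}
    (h : ∀ N ∈ S, N.Normal) : (genBy S).Normal := by
  constructor
  intro x hx g
  have hmap : Subgroup.map (MulAut.conj g).toMonoidHom (genBy S) ≤ genBy S := by
    rw [genBy, MonoidHom.map_closure]
    apply Subgroup.closure_mono
    rintro y ⟨z, hz, rfl⟩
    simp only [Set.mem_iUnion] at hz ⊢
    obtain ⟨N, hN, hzN⟩ := hz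
    exact ⟨N, hN, (h N hN).conj_mem z hzN g⟩
  exact hmap ⟨x, hx, rfl⟩

/-- `O_𝒫(G)`: the subgroup generated by all normal `𝒫`-subgroups. -/
def Op (P : (X : Type) → [inst : Group X] → Prop) (G : Type) [Group G] : Subgroup G :=
  genBy {N : Subgroup G | N.Normal ∧ P ↥N}

instance Op_normal (P : (X : Type) → [inst : Group X] → Prop) (G : Type) [Group G] :
    (Op P G).Normal :=
  genBy_normal fun _ hN => hN.1

/-- `N` is normal with `𝒫` quotient. -/
def QuotIsP (P : (X : Type) → [inst : Group X] → Prop) {G : Type} [Group G]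
    (N : Subgroup G) : Prop :=
  ∃ h : N.Normal, haveI := h; P (G ⧸ N)

/-- `O^𝒫(G)`: the intersection of all normal subgroups with `𝒫` quotient. -/
def Oup (P : (X : Type) → [inst : Group X] → Prop) (G : Type) [Group G] : Subgroup G :=
  ⨅ (N : Subgroup G) (_ : QuotIsP P N), N

/-- A `𝒫`-component. -/
def IsPComponent (P : (X : Type) → [inst : Group X] → Prop) {G : Type} [Group G]
    (K : Subgroup G) : Prop :=
  IsSubnormal K ∧ IsQuasisimple (↥K ⧸ Op P ↥K) ∧ Oup P ↥K = ⊤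

/-- The solvable radical. -/
def solRad (G : Type) [Group G] : Subgroup G :=
  genBy {N : Subgroup G | N.Normal ∧ IsSolvable ↥N}

/-- `O_{𝒫,E}(G) = O_𝒫(G) · L_𝒫(G)`. -/
def OPE (P : (X : Type) → [inst : Group X] → Prop) (G : Type) [Group G] : Subgroup G :=
  Op P G ⊔ sSup {K : Subgroup G | IsPComponent P K}



/-- The subgroup of points fixed by a single element `a`. -/
def fixedBySub {A : Type} (G : Type) [Monoid A] [Group G] [MulDistribMulAction A G]
    (a : A) : Subgroup G where
  carrier := {x : G | a • x = x}
  one_mem' := smul_one a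
  mul_mem' := fun {x y} hx hy => by
    show a • (x * y) = x * y
    rw [smul_mul', hx, hy]
  inv_mem' := fun {x} hx => by
    show a • x⁻¹ = x⁻¹
    rw [smul_inv', hx]

/-- The subgroup of points fixed by every element of a subgroup `B` of `A`. -/
def fixedOfSub {A : Type} (G : Type) [Group A] [Group G] [MulDistribMulAction A G]
    (B : Subgroup A) : Subgroup G where
  carrier := {x : G | ∀ b ∈ B, b • x = x}
  one_mem' := fun b _ => smul_one b
  mul_mem' := fun {x y} hx hy b hb => by rw [smul_mul', hx b hb, hy b hb]
  inv_mem' := fun {x} hx b hb => by rw [smul_inv', hx b hb]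

/-- The action of `A` restricted to an `A`-invariant subgroup. -/
def invSubAction (A : Type) {G : Type} [Monoid A] [Group G] [MulDistribMulAction A G]
    (K : Subgroup G) (hK : ∀ (a : A) (x : G), x ∈ K → a • x ∈ K) :
    MulDistribMulAction A ↥K where
  smul a x := ⟨a • (x : G), hK a x x.2⟩
  one_smul x := Subtype.ext (one_smul A (x : G))
  mul_smul a b x := Subtype.ext (mul_smul a b (x : G))
  smul_mul a x y := Subtype.ext (smul_mul' a (x : G) (y : G))
  smul_one a := Subtype.ext (smul_one a)

/-- The map induced by `a • ·` on the quotient by an `A`-invariant normal subgroup. -/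
def invQuotSMul (A : Type) {G : Type} [Monoid A] [Group G] [MulDistribMulAction A G]
    (N : Subgroup G) [N.Normal] (hN : ∀ (a : A) (x : G), x ∈ N → a • x ∈ N) (a : A) :
    G ⧸ N → G ⧸ N :=
  Quotient.map' (a • ·) (fun x y h => by
    rw [QuotientGroup.leftRel_apply] at h ⊢
    have := hN a _ h
    rwa [smul_mul', smul_inv'] at this)

theorem invQuotSMul_mk (A : Type) {G : Type} [Monoid A] [Group G] [MulDistribMulAction A G]
    (N : Subgroup G) [N.Normal] (hN : ∀ (a : A) (x : G), x ∈ N → a • x ∈ N) (a : A) (x : G) :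
    invQuotSMul A N hN a (x : G ⧸ N) = ((a • x : G) : G ⧸ N) := rfl

/-- The action of `A` induced on the quotient by an `A`-invariant normal subgroup. -/
def invQuotAction (A : Type) {G : Type} [Monoid A] [Group G] [MulDistribMulAction A G]
    (N : Subgroup G) [N.Normal] (hN : ∀ (a : A) (x : G), x ∈ N → a • x ∈ N) :
    MulDistribMulAction A (G ⧸ N) where
  smul := invQuotSMul A N hN
  one_smul q := QuotientGroup.induction_on q fun x => by
    show invQuotSMul A N hN 1 (x : G ⧸ N) = (x : G ⧸ N)
    rw [invQuotSMul_mk, one_smul]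
  mul_smul a b q := QuotientGroup.induction_on q fun x => by
    show invQuotSMul A N hN (a * b) (x : G ⧸ N)
        = invQuotSMul A N hN a (invQuotSMul A N hN b (x : G ⧸ N))
    rw [invQuotSMul_mk, invQuotSMul_mk, invQuotSMul_mk, mul_smul]
  smul_mul a q r := Quotient.inductionOn₂' q r fun x y => by
    show invQuotSMul A N hN a ((x : G ⧸ N) * (y : G ⧸ N))
        = invQuotSMul A N hN a (x : G ⧸ N) * invQuotSMul A N hN a (y : G ⧸ N)
    rw [← QuotientGroup.mk_mul, invQuotSMul_mk, invQuotSMul_mk, invQuotSMul_mk,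
      ← QuotientGroup.mk_mul, smul_mul']
  smul_one a := by
    show invQuotSMul A N hN a ((1 : G) : G ⧸ N) = ((1 : G) : G ⧸ N)
    rw [invQuotSMul_mk, smul_one]

/-- The action of `A` induced on the central quotient. -/
def centerQuotAction (A : Type) (X : Type) [Group A] [Group X] [MulDistribMulAction A X] :
    MulDistribMulAction A (X ⧸ Subgroup.center X) :=
  invQuotAction A (Subgroup.center X) (fun a x hx => by
    rw [Subgroup.mem_center_iff] at hx ⊢
    intro y
    calc y * a • x = a • (a⁻¹ • y * x) := by rw [smul_mul', smul_inv_smul]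
    _ = a • (x * a⁻¹ • y) := by rw [hx (a⁻¹ • y)]
    _ = a • x * y := by rw [smul_mul', smul_inv_smul])


/-- `X` is `A`-quasisimple: it is generated by its components, the set of components
is nonempty, and `A` permutes the components transitively. -/
def IsAQuasisimple (A X : Type) [Group A] [Group X] [MulDistribMulAction A X] : Prop :=
  {K : Subgroup X | IsComponent K}.Nonempty ∧
  sSup {K : Subgroup X | IsComponent K} = ⊤ ∧
  ∀ K L : Subgroup X, IsComponent K → IsComponent L → ∃ a : A, a • K = L

/-- An `A`-component: the subgroup generated by an orbit of `A` on the components. -/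
def IsAComponent (A : Type) {G : Type} [Group A] [Group G] [MulDistribMulAction A G]
    (K : Subgroup G) : Prop :=
  ∃ L : Subgroup G, IsComponent L ∧ K = ⨆ a : A, a • L

/-- An `(A,𝒫)`-component: an `A`-invariant subnormal subgroup `K` with
`K = O^𝒫(K)` and `K/O_𝒫(K)` `A`-quasisimple under the induced action. -/
def IsAPComponent (P : (X : Type) → [inst : Group X] → Prop) (A : Type) {G : Type}
    [Group A] [Group G] [MulDistribMulAction A G] (K : Subgroup G) : Prop :=
  IsSubnormal K ∧ Oup P ↥K = ⊤ ∧
  ∃ hK : ∀ (a : A) (x : G), x ∈ K → a • x ∈ K,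
    letI := invSubAction A K hK
    ∃ hOp : ∀ (a : A) (x : ↥K), x ∈ Op P ↥K → a • x ∈ Op P ↥K,
      letI := invQuotAction A (Op P ↥K) hOp
      IsAQuasisimple A (↥K ⧸ Op P ↥K)

/-- The commutator `[X, t]` of a subgroup with an element acting on `G`;
the subgroup generated by all `x⁻¹ * (t • x)`, `x ∈ X`. -/
def commSub {A : Type} {G : Type} [Monoid A] [Group G] [MulDistribMulAction A G]
    (t : A) (X : Subgroup G) : Subgroup G :=
  Subgroup.closure {y : G | ∃ x ∈ X, y = x⁻¹ * (t • x)}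


/-- `O_{n𝒫}(G)`: the subgroup generated by all `A`-invariant normal subgroups whose
fixed-point subgroup under `A` is a `𝒫`-group. -/
def OnP (P : (X : Type) → [inst : Group X] → Prop) (A : Type) (G : Type) [Monoid A] [Group G]
    [MulDistribMulAction A G] : Subgroup G :=
  genBy {N : Subgroup G | N.Normal ∧ (∀ (a : A) (x : G), x ∈ N → a • x ∈ N) ∧
    P ↥(N ⊓ FixedPoints.subgroup A G)}

/-- The group-theoretic property "is solvable". -/
def solP : (X : Type) → [inst : Group X] → Prop := fun X _ => IsSolvable X


theorem le_genBy {G : Type} [Group G] {S : Set (Subgroup G)} {M : Subgroup G} (hM : M ∈ S) :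
    M ≤ genBy S := fun _ hx =>
  Subgroup.subset_closure (Set.mem_biUnion hM hx)

theorem genBy_le {G : Type} [Group G] {S : Set (Subgroup G)} {K : Subgroup G}
    (h : ∀ M ∈ S, M ≤ K) : genBy S ≤ K :=
  (Subgroup.closure_le K).2 (Set.iUnion₂_subset h)

theorem le_Op {P : (X : Type) → [inst : Group X] → Prop} {G : Type} [Group G]
    {M : Subgroup G} (hM : M.Normal) (hP : P ↥M) : M ≤ Op P G :=
  le_genBy (S := {N : Subgroup G | N.Normal ∧ P ↥N}) ⟨hM, hP⟩

theorem Op_le {P : (X : Type) → [inst : Group X] → Prop} {G : Type} [Group G]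
    {K : Subgroup G} (h : ∀ M : Subgroup G, M.Normal → P ↥M → M ≤ K) : Op P G ≤ K :=
  genBy_le fun M hM => h M hM.1 hM.2

/-- As soon as a finite group has a normal `𝒫`-subgroup, `O_𝒫(G)` is itself a `𝒫`-group. -/
theorem Op_prop {P : (X : Type) → [inst : Group X] → Prop} {G : Type} [Group G] [Finite G]
    (hJoin : ∀ (M N : Subgroup G) [M.Normal] [N.Normal], P ↥M → P ↥N → P ↥(M ⊔ N))
    {M : Subgroup G} (hM : M.Normal) (hP : P ↥M) : P ↥(Op P G) := by
  obtain ⟨K, -, ⟨hK, hPK⟩, hmax⟩ :=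
    (Set.toFinite {N : Subgroup G | N.Normal ∧ P ↥N}).exists_le_maximal
      (show M ∈ {N : Subgroup G | N.Normal ∧ P ↥N} from ⟨hM, hP⟩)
  have hOp : Op P G = K := by
    refine le_antisymm (Op_le fun L hL hPL => ?_) (le_Op hK hPK)
    have hsup : K ⊔ L ∈ {N : Subgroup G | N.Normal ∧ P ↥N} :=
      ⟨Subgroup.sup_normal K L, hJoin K L hPK hPL⟩
    exact le_sup_right.trans (hmax hsup le_sup_left)
  rwa [hOp]

theorem map_Op_equiv {P : (X : Type) → [inst : Group X] → Prop}
    (hIso : ∀ (X Y : Type) [Group X] [Group Y] [Finite X], Nonempty (X ≃* Y) → P X → P Y)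
    {X Y : Type} [Group X] [Group Y] [Finite X] (e : X ≃* Y) :
    (Op P X).map e.toMonoidHom = Op P Y := by
  have key : ∀ {X Y : Type} [Group X] [Group Y] [Finite X] (e : X ≃* Y),
      (Op P X).map e.toMonoidHom ≤ Op P Y := by
    intro X Y _ _ _ e
    rw [Subgroup.map_le_iff_le_comap]
    refine Op_le fun M hM hP => ?_
    rw [← Subgroup.map_le_iff_le_comap]
    exact le_Op (hM.map _ e.surjective)
      (hIso _ _ ⟨M.equivMapOfInjective e.toMonoidHom e.injective⟩ hP)
  have : Finite Y := Finite.of_equiv X e.toEquiv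
  refine le_antisymm (key e) fun y hy => ?_
  exact ⟨e.symm y, key e.symm ⟨y, hy, rfl⟩, e.apply_symm_apply y⟩

theorem Op_characteristic {P : (X : Type) → [inst : Group X] → Prop}
    (hIso : ∀ (X Y : Type) [Group X] [Group Y] [Finite X], Nonempty (X ≃* Y) → P X → P Y)
    (G : Type) [Group G] [Finite G] : (Op P G).Characteristic :=
  Subgroup.characteristic_iff_map_eq.2 fun e => map_Op_equiv hIso e

theorem map_Op_subtype_of_normal {P : (X : Type) → [inst : Group X] → Prop}
    (hIso : ∀ (X Y : Type) [Group X] [Group Y] [Finite X], Nonempty (X ≃* Y) → P X → P Y)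
    (hSub : ∀ (X : Type) [Group X] [Finite X], P X → ∀ H : Subgroup X, P ↥H)
    (hJoin : ∀ (X : Type) [Group X] [Finite X] (M N : Subgroup X) [M.Normal] [N.Normal],
      P ↥M → P ↥N → P ↥(M ⊔ N))
    {G : Type} [Group G] [Finite G] (N : Subgroup G) [N.Normal] :
    (Op P ↥N).map N.subtype = N ⊓ Op P G := by
  have := Op_characteristic hIso ↥N
  apply le_antisymm
  · refine le_inf (Subgroup.map_subtype_le _) ?_
    rw [Subgroup.map_le_iff_le_comap]
    refine Op_le fun M hM hP => ?_
    rw [← Subgroup.map_le_iff_le_comap]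
    have hPN : P ↥(Op P ↥N) := Op_prop (hJoin ↥N) hM hP
    exact (Subgroup.map_mono (le_Op hM hP)).trans (le_Op inferInstance
      (hIso _ _ ⟨(Op P ↥N).equivMapOfInjective N.subtype N.subtype_injective⟩ hPN))
  · rw [inf_comm, ← Subgroup.subgroupOf_map_subtype]
    refine Subgroup.map_mono ?_
    by_cases h : ∃ M : Subgroup G, M.Normal ∧ P ↥M
    · obtain ⟨M, hM, hP⟩ := h
      have hPG : P ↥(Op P G) := Op_prop (hJoin G) hM hP
      refine le_Op inferInstance (hIso _ _ ⟨?_⟩ (hSub _ hPG (N.subgroupOf (Op P G))))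
      exact ((N.subgroupOf (Op P G)).equivMapOfInjective _ (Op P G).subtype_injective).trans
        ((MulEquiv.subgroupCongr (by
          rw [Subgroup.subgroupOf_map_subtype, Subgroup.subgroupOf_map_subtype, inf_comm])).trans
        (((Op P G).subgroupOf N).equivMapOfInjective _ N.subtype_injective).symm)
    · have hbot : Op P G = ⊥ := le_bot_iff.1 (Op_le fun M hM hP => (h ⟨M, hM, hP⟩).elim)
      rw [hbot, Subgroup.bot_subgroupOf]
      exact bot_le

theorem map_Op_subtype_of_normal_subgroupOf {P : (X : Type) → [inst : Group X] → Prop}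
    (hIso : ∀ (X Y : Type) [Group X] [Group Y] [Finite X], Nonempty (X ≃* Y) → P X → P Y)
    (hSub : ∀ (X : Type) [Group X] [Finite X], P X → ∀ H : Subgroup X, P ↥H)
    (hJoin : ∀ (X : Type) [Group X] [Finite X] (M N : Subgroup X) [M.Normal] [N.Normal],
      P ↥M → P ↥N → P ↥(M ⊔ N))
    {G : Type} [Group G] [Finite G] {H K : Subgroup G} (hle : H ≤ K)
    (hnorm : (H.subgroupOf K).Normal) :
    (Op P ↥H).map H.subtype = H ⊓ (Op P ↥K).map K.subtype := by
  have h := congrArg (Subgroup.map K.subtype)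
    (map_Op_subtype_of_normal hIso hSub hJoin (H.subgroupOf K))
  rw [Subgroup.map_inf _ _ _ K.subtype_injective, Subgroup.subgroupOf_map_subtype,
    inf_eq_left.2 hle] at h
  rw [← h, ← map_Op_equiv hIso (Subgroup.subgroupOfEquivOfLe hle), Subgroup.map_map,
    Subgroup.map_map]
  rfl

theorem statement_1
    (P : (X : Type) → [inst : Group X] → Prop)
    (hIso : ∀ (X Y : Type) [Group X] [Group Y] [Finite X], Nonempty (X ≃* Y) → P X → P Y)
    (hSubClosed : ∀ (X : Type) [Group X] [Finite X], P X → ∀ H : Subgroup X, P ↥H)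
    (hQuotClosed : ∀ (X : Type) [Group X] [Finite X], P X → ∀ (N : Subgroup X) [N.Normal], P (X ⧸ N))
    (hInfClosed : ∀ (X : Type) [Group X] [Finite X] (M N : Subgroup X) [M.Normal] [N.Normal],
      P (X ⧸ M) → P (X ⧸ N) → P (X ⧸ (M ⊓ N)))
    (hJoinClosed : ∀ (X : Type) [Group X] [Finite X] (M N : Subgroup X) [M.Normal] [N.Normal],
      P ↥M → P ↥N → P ↥(M ⊔ N))
    (G : Type) [Group G] [Finite G] (N : Subgroup G) (hN : IsSubnormal N) :
    (Op P ↥N).map N.subtype = N ⊓ Op P G := by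
  obtain ⟨n, c, rfl, hlast, hc⟩ := hN
  suffices h : ∀ i, (Op P ↥(c i)).map (c i).subtype = c i ⊓ Op P G from h 0
  intro i
  induction i using Fin.reverseInduction with
  | last =>
    rw [hlast]
    exact map_Op_subtype_of_normal hIso hSubClosed hJoinClosed ⊤
  | cast i ih =>
    rw [map_Op_subtype_of_normal_subgroupOf hIso hSubClosed hJoinClosed (hc i).1 (hc i).2, ih,
      ← inf_assoc, inf_eq_left.2 (hc i).1]

end PaperPF
end

section
/- Let G be a finite group with G = MN, where M and N are normal subgroups of G. Then O^𝒫(G) = O^𝒫(M)·O^𝒫(N). -/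
open Pointwise

namespace PaperPF
set_option linter.unusedVariables false

/-- `𝒫` is invariant under isomorphisms of finite groups. -/
def IsoClosed (P : (X : Type) → [inst : Group X] → Prop) : Prop :=
  ∀ (X Y : Type) [Group X] [Group Y] [Finite X], Nonempty (X ≃* Y) → P X → P Y

/-- `𝒫` passes to subgroups of finite groups. -/
def SubgroupClosed (P : (X : Type) → [inst : Group X] → Prop) : Prop :=
  ∀ (X : Type) [Group X] [Finite X], P X → ∀ H : Subgroup X, P ↥H

/-- `𝒫` passes to quotients of finite groups. -/
def QuotientClosed (P : (X : Type) → [inst : Group X] → Prop) : Prop :=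
  ∀ (X : Type) [Group X] [Finite X], P X → ∀ (N : Subgroup X) [N.Normal], P (X ⧸ N)

/-- `𝒫`-quotients of finite groups are closed under intersections of their kernels. -/
def InfClosed (P : (X : Type) → [inst : Group X] → Prop) : Prop :=
  ∀ (X : Type) [Group X] [Finite X] (M N : Subgroup X) [M.Normal] [N.Normal],
    P (X ⧸ M) → P (X ⧸ N) → P (X ⧸ (M ⊓ N))

section Oup

variable {P : (X : Type) → [inst : Group X] → Prop}

theorem Oup_le {G : Type} [Group G] {N : Subgroup G} (h : QuotIsP P N) : Oup P G ≤ N :=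
  iInf₂_le N h

theorem le_Oup {G : Type} [Group G] {K : Subgroup G}
    (h : ∀ N : Subgroup G, QuotIsP P N → K ≤ N) : K ≤ Oup P G :=
  le_iInf₂ h

theorem QuotIsP.comap (hIso : IsoClosed P) (hSub : SubgroupClosed P) {X G : Type}
    [Group X] [Group G] [Finite G] (f : X →* G) {Q : Subgroup G} (hQ : QuotIsP P Q) :
    QuotIsP P (Q.comap f) := by
  obtain ⟨hn, hP⟩ := hQ
  refine ⟨inferInstance, ?_⟩
  have hker : ((QuotientGroup.mk' Q).comp f).ker = Q.comap f := by
    rw [← MonoidHom.comap_ker, QuotientGroup.ker_mk']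
  exact hIso _ _ ⟨((QuotientGroup.quotientMulEquivOfEq hker).symm.trans
    (QuotientGroup.quotientKerEquivRange _)).symm⟩
    (hSub _ hP ((QuotientGroup.mk' Q).comp f).range)

theorem Oup_le_comap (hIso : IsoClosed P) (hSub : SubgroupClosed P) {X G : Type}
    [Group X] [Group G] [Finite G] (f : X →* G) : Oup P X ≤ (Oup P G).comap f :=
  Subgroup.map_le_iff_le_comap.1 <| le_Oup fun _ hQ =>
    Subgroup.map_le_iff_le_comap.2 (Oup_le (hQ.comap hIso hSub f))

theorem Oup_characteristic (hIso : IsoClosed P) (hSub : SubgroupClosed P) (G : Type)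
    [Group G] [Finite G] : (Oup P G).Characteristic :=
  Subgroup.characteristic_iff_le_comap.2 fun φ => Oup_le_comap hIso hSub φ.toMonoidHom

theorem quotIsP_Oup (hInf : InfClosed P) {G : Type} [Group G] [Finite G]
    {N : Subgroup G} (hN : QuotIsP P N) : QuotIsP P (Oup P G) := by
  obtain ⟨K, hK⟩ := (Set.toFinite {K : Subgroup G | QuotIsP P K}).exists_minimal ⟨N, hN⟩
  have hmin : K ≤ Oup P G := le_Oup fun L hL => by
    obtain ⟨hKn, hKP⟩ := hK.1
    obtain ⟨hLn, hLP⟩ := hL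
    have hKL : QuotIsP P (K ⊓ L) := ⟨inferInstance, hInf G K L hKP hLP⟩
    exact (hK.2 hKL inf_le_left).trans inf_le_right
  rw [(Oup_le hK.1).antisymm hmin]
  exact hK.1

theorem range_of_Oup_le_ker (hIso : IsoClosed P) (hQuot : QuotientClosed P) {X Y : Type}
    [Group X] [Finite X] [Group Y] (f : X →* Y) (hX : QuotIsP P (Oup P X))
    (hf : Oup P X ≤ f.ker) : P ↥f.range := by
  obtain ⟨hn, hP⟩ := hX
  have hr : (QuotientGroup.lift (Oup P X) f hf).range = f.range := by
    ext y
    constructor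
    · rintro ⟨x, rfl⟩
      obtain ⟨x, rfl⟩ := QuotientGroup.mk_surjective x
      exact ⟨x, rfl⟩
    · rintro ⟨x, rfl⟩
      exact ⟨(x : X ⧸ Oup P X), rfl⟩
  exact hIso _ _ ⟨(QuotientGroup.quotientKerEquivRange _).trans (MulEquiv.subgroupCongr hr)⟩
    (hQuot _ hP (QuotientGroup.lift (Oup P X) f hf).ker)

theorem quotIsP_top (hIso : IsoClosed P) (h : P Unit) (X : Type) [Group X] :
    QuotIsP P (⊤ : Subgroup X) := by
  refine ⟨inferInstance, ?_⟩
  have := QuotientGroup.subsingleton_quotient_top (G := X)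
  have : Unique (X ⧸ (⊤ : Subgroup X)) := Unique.mk' _
  exact hIso Unit _ ⟨MulEquiv.ofUnique (M := Unit) (N := X ⧸ (⊤ : Subgroup X))⟩ h

theorem Oup_eq_top (hIso : IsoClosed P) (hSub : SubgroupClosed P) (h : ¬ P Unit) (X : Type)
    [Group X] [Finite X] : Oup P X = ⊤ :=
  top_le_iff.1 <| le_Oup fun N ⟨_, hP⟩ => absurd
    (hIso _ _ ⟨MulEquiv.ofUnique (M := (⊥ : Subgroup (X ⧸ N))) (N := Unit)⟩ (hSub _ hP ⊥)) h

end Oup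

theorem statement_2
    (P : (X : Type) → [inst : Group X] → Prop)
    (hIso : ∀ (X Y : Type) [Group X] [Group Y] [Finite X], Nonempty (X ≃* Y) → P X → P Y)
    (hSubClosed : ∀ (X : Type) [Group X] [Finite X], P X → ∀ H : Subgroup X, P ↥H)
    (hQuotClosed : ∀ (X : Type) [Group X] [Finite X], P X → ∀ (N : Subgroup X) [N.Normal], P (X ⧸ N))
    (hInfClosed : ∀ (X : Type) [Group X] [Finite X] (M N : Subgroup X) [M.Normal] [N.Normal],
      P (X ⧸ M) → P (X ⧸ N) → P (X ⧸ (M ⊓ N)))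
    (hJoinClosed : ∀ (X : Type) [Group X] [Finite X] (M N : Subgroup X) [M.Normal] [N.Normal],
      P ↥M → P ↥N → P ↥(M ⊔ N))
    (G : Type) [Group G] [Finite G] (M N : Subgroup G) [M.Normal] [N.Normal]
    (hMN : M ⊔ N = ⊤) :
    Oup P G = (Oup P ↥M).map M.subtype ⊔ (Oup P ↥N).map N.subtype := by
  apply le_antisymm
  · by_cases h1 : P Unit
    · have := Oup_characteristic hIso hSubClosed ↥M
      have := Oup_characteristic hIso hSubClosed ↥N
      set K := (Oup P ↥M).map M.subtype ⊔ (Oup P ↥N).map N.subtype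
      have hKn : K.Normal := inferInstance
      refine Oup_le ⟨hKn, ?_⟩
      have image_isP : ∀ L : Subgroup G, (Oup P ↥L).map L.subtype ≤ K →
          P ↥(L.map (QuotientGroup.mk' K)) := by
        intro L hL
        have hr : ((QuotientGroup.mk' K).comp L.subtype).range = L.map (QuotientGroup.mk' K) := by
          rw [MonoidHom.range_comp, L.range_subtype]
        rw [← hr]
        refine range_of_Oup_le_ker hIso hQuotClosed _
          (quotIsP_Oup hInfClosed (quotIsP_top hIso h1 _)) ?_
        rw [← MonoidHom.comap_ker, QuotientGroup.ker_mk']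
        exact Subgroup.map_le_iff_le_comap.1 hL
      have hmapM : (M.map (QuotientGroup.mk' K)).Normal :=
        Subgroup.Normal.map inferInstance _ (QuotientGroup.mk'_surjective K)
      have hmapN : (N.map (QuotientGroup.mk' K)).Normal :=
        Subgroup.Normal.map inferInstance _ (QuotientGroup.mk'_surjective K)
      have hjoin := hJoinClosed _ _ _ (image_isP M le_sup_left) (image_isP N le_sup_right)
      rw [← Subgroup.map_sup, hMN,
        Subgroup.map_top_of_surjective _ (QuotientGroup.mk'_surjective K)] at hjoin
      exact hIso _ _ ⟨Subgroup.topEquiv⟩ hjoin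
    · simp [Oup_eq_top hIso hSubClosed h1, ← MonoidHom.range_eq_map, hMN]
  · exact sup_le (Subgroup.map_le_iff_le_comap.2 (Oup_le_comap hIso hSubClosed _))
      (Subgroup.map_le_iff_le_comap.2 (Oup_le_comap hIso hSubClosed _))

end PaperPF
end

section
/- Let K be a 𝒫-component of a finite group G. Then K is perfect, and the preimage in K of the center of K/O_𝒫(K) is the unique maximal normal subgroup of K: it is a proper subgroup of K containing every proper normal subgroup of K. -/
open Pointwise

namespace PaperPF
set_option linter.unusedVariables false

/-- A nonempty family of normal `P`-subgroups has a largest member when `P` is closed under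
products of normal subgroups. -/
theorem P_Op_of_exists {P : (X : Type) → [inst : Group X] → Prop} {K : Type} [Group K] [Finite K]
    (hJoin : ∀ (M N : Subgroup K) [M.Normal] [N.Normal], P ↥M → P ↥N → P ↥(M ⊔ N))
    (hne : {N : Subgroup K | N.Normal ∧ P ↥N}.Nonempty) : P ↥(Op P K) := by
  obtain ⟨N, ⟨hN, hPN⟩, hmax⟩ :=
    (Set.toFinite {N : Subgroup K | N.Normal ∧ P ↥N}).exists_maximal hne
  have hOp : Op P K = N := by
    apply le_antisymm
    · refine (Subgroup.closure_le _).2 (Set.iUnion₂_subset fun M hM => ?_)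
      obtain ⟨hMn, hPM⟩ := hM
      have hNM : N ⊔ M ≤ N := hmax ⟨inferInstance, hJoin N M hPN hPM⟩ le_sup_left
      exact (le_sup_right : M ≤ N ⊔ M).trans hNM
    · intro x hx
      exact Subgroup.subset_closure (Set.mem_biUnion (show N ∈ _ from ⟨hN, hPN⟩) hx)
  rw [hOp]
  exact hPN

/-- In a group with `O^𝒫(K) = K`, a normal supplement of `O_𝒫(K)` is the whole group. -/
theorem eq_top_of_sup_Op_eq_top {P : (X : Type) → [inst : Group X] → Prop}
    (hIso : ∀ (X Y : Type) [Group X] [Group Y] [Finite X], Nonempty (X ≃* Y) → P X → P Y)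
    (hQuotClosed : ∀ (X : Type) [Group X] [Finite X], P X →
      ∀ (N : Subgroup X) [N.Normal], P (X ⧸ N))
    (hJoinClosed : ∀ (X : Type) [Group X] [Finite X] (M N : Subgroup X) [M.Normal] [N.Normal],
      P ↥M → P ↥N → P ↥(M ⊔ N))
    {K : Type} [Group K] [Finite K] (hK : Oup P K = ⊤) (N : Subgroup K) [hN : N.Normal]
    (h : N ⊔ Op P K = ⊤) : N = ⊤ := by
  rcases Set.eq_empty_or_nonempty {N : Subgroup K | N.Normal ∧ P ↥N} with hS | hS
  · have hbot : Op P K = ⊥ := by simp [Op, genBy, hS]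
    simpa [hbot] using h
  have hPO : P ↥(Op P K) := P_Op_of_exists (hJoinClosed K) hS
  let f : ↥(Op P K) →* K ⧸ N := (QuotientGroup.mk' N).comp (Op P K).subtype
  have hf : Function.Surjective f := by
    rw [← MonoidHom.range_eq_top, MonoidHom.range_comp, Subgroup.range_subtype,
      ← Subgroup.map_top_of_surjective _ (QuotientGroup.mk'_surjective N), ← h, Subgroup.map_sup,
      (Subgroup.map_eq_bot_iff _).2 (QuotientGroup.ker_mk' N).ge, bot_sup_eq]
  have hPq : P (K ⧸ N) := hIso _ _ ⟨QuotientGroup.quotientKerEquivOfSurjective f hf⟩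
    (hQuotClosed _ hPO f.ker)
  exact top_le_iff.1 (hK.ge.trans (iInf₂_le N ⟨hN, hPq⟩))

/-- Every normal subgroup of a quasisimple group is central or the whole group. -/
theorem IsQuasisimple.le_center_or_eq_top {X : Type} [Group X] (hX : IsQuasisimple X)
    (N : Subgroup X) [hN : N.Normal] : N ≤ Subgroup.center X ∨ N = ⊤ := by
  obtain ⟨hperf, hsimple, -⟩ := hX
  have hsurj := QuotientGroup.mk'_surjective (Subgroup.center X)
  rcases (hN.map _ hsurj).eq_bot_or_eq_top with h | h
  · left
    rwa [Subgroup.map_eq_bot_iff, QuotientGroup.ker_mk'] at h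
  · right
    have hsup : N ⊔ Subgroup.center X = ⊤ := by
      have := congrArg (Subgroup.comap (QuotientGroup.mk' (Subgroup.center X))) h
      rwa [Subgroup.comap_map_eq, QuotientGroup.ker_mk', Subgroup.comap_top] at this
    rw [← top_le_iff, ← hperf, commutator_def, Subgroup.commutator_le]
    intro a _ b _
    obtain ⟨n, hn, z, hz, rfl⟩ := Subgroup.mem_sup_of_normal_right.1 (hsup.ge (Subgroup.mem_top a))
    rw [Subgroup.mem_center_iff] at hz
    have hcomm : n * z * b * (n * z)⁻¹ * b⁻¹ = n * (b * n⁻¹ * b⁻¹) := by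
      rw [mul_assoc n z b, ← hz b]
      group
    rw [commutatorElement_def, hcomm]
    exact N.mul_mem hn (hN.conj_mem _ (N.inv_mem hn) b)

theorem statement_3
    (P : (X : Type) → [inst : Group X] → Prop)
    (hIso : ∀ (X Y : Type) [Group X] [Group Y] [Finite X], Nonempty (X ≃* Y) → P X → P Y)
    (hSubClosed : ∀ (X : Type) [Group X] [Finite X], P X → ∀ H : Subgroup X, P ↥H)
    (hQuotClosed : ∀ (X : Type) [Group X] [Finite X], P X → ∀ (N : Subgroup X) [N.Normal], P (X ⧸ N))
    (hInfClosed : ∀ (X : Type) [Group X] [Finite X] (M N : Subgroup X) [M.Normal] [N.Normal],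
      P (X ⧸ M) → P (X ⧸ N) → P (X ⧸ (M ⊓ N)))
    (hJoinClosed : ∀ (X : Type) [Group X] [Finite X] (M N : Subgroup X) [M.Normal] [N.Normal],
      P ↥M → P ↥N → P ↥(M ⊔ N))
    (G : Type) [Group G] [Finite G] (K : Subgroup G) (hK : IsPComponent P K) :
    commutator ↥K = ⊤ ∧
    (Subgroup.center (↥K ⧸ Op P ↥K)).comap (QuotientGroup.mk' (Op P ↥K)) ≠ ⊤ ∧
    ∀ N : Subgroup ↥K, N.Normal → N ≠ ⊤ →
      N ≤ (Subgroup.center (↥K ⧸ Op P ↥K)).comap (QuotientGroup.mk' (Op P ↥K)) := by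
  obtain ⟨-, hq, hO⟩ := hK
  have hsurj := QuotientGroup.mk'_surjective (Op P ↥K)
  have hsup {N : Subgroup ↥K} (h : N.map (QuotientGroup.mk' (Op P ↥K)) = ⊤) :
      N ⊔ Op P ↥K = ⊤ := by
    have := congrArg (Subgroup.comap (QuotientGroup.mk' (Op P ↥K))) h
    rwa [Subgroup.comap_map_eq, QuotientGroup.ker_mk', Subgroup.comap_top] at this
  refine ⟨?_, ?_, ?_⟩
  · refine eq_top_of_sup_Op_eq_top hIso hQuotClosed hJoinClosed hO _ (hsup ?_)
    rw [commutator_def, Subgroup.map_commutator, Subgroup.map_top_of_surjective _ hsurj]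
    exact hq.1
  · intro h
    have hcenter : Subgroup.center (↥K ⧸ Op P ↥K) = ⊤ :=
      Subgroup.comap_injective hsurj (h.trans (Subgroup.comap_top _).symm)
    obtain ⟨-, -, a, b, hab⟩ := hq
    have := QuotientGroup.subsingleton_quotient_top (G := ↥K ⧸ Op P ↥K)
    rw [← hcenter] at this
    exact hab (Subsingleton.elim _ _)
  · intro N hN hNtop
    rw [← Subgroup.map_le_iff_le_comap]
    have := hN.map _ hsurj
    refine (hq.le_center_or_eq_top _).resolve_right fun h => hNtop ?_
    exact eq_top_of_sup_Op_eq_top hIso hQuotClosed hJoinClosed hO N (hsup h)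

end PaperPF
end

section
/- Let G be a finite group and set Ḡ = G/O_𝒫(G). For every 𝒫-component K of G, the image K̄ of K in Ḡ is a component of Ḡ, and the map K ↦ K̄ from the set of 𝒫-components of G to the set of components of Ḡ is injective. If, in addition, every 𝒫-group is solvable, then this map is a bijection onto the set of components of Ḡ. -/
open Pointwise

namespace PaperPF
set_option linter.unusedVariables false

/-- The closure properties of `P` under isomorphisms, subgroups, quotients and normal products. -/
structure IsQuotientFittingClass (P : (X : Type) → [inst : Group X] → Prop) : Prop where
  iso : ∀ (X Y : Type) [Group X] [Group Y] [Finite X], Nonempty (X ≃* Y) → P X → P Y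
  subgroup : ∀ (X : Type) [Group X] [Finite X], P X → ∀ H : Subgroup X, P ↥H
  quotient : ∀ (X : Type) [Group X] [Finite X], P X → ∀ (N : Subgroup X) [N.Normal], P (X ⧸ N)
  sup : ∀ (X : Type) [Group X] [Finite X] (M N : Subgroup X) [M.Normal] [N.Normal],
    P ↥M → P ↥N → P ↥(M ⊔ N)

/-- `X` satisfies `P` or is trivial. -/
def IsPOrTrivial (P : (X : Type) → [inst : Group X] → Prop) (X : Type) [Group X] : Prop :=
  P X ∨ Subsingleton X

section PClosure

variable {P : (X : Type) → [inst : Group X] → Prop}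

theorem IsPOrTrivial.of_injective (hP : IsQuotientFittingClass P) {X Y : Type} [Group X] [Group Y]
    [Finite Y] (f : X →* Y) (hf : Function.Injective f) (h : IsPOrTrivial P Y) :
    IsPOrTrivial P X := by
  rcases h with h | h
  · exact Or.inl (hP.iso _ _ ⟨(MonoidHom.ofInjective hf).symm⟩ (hP.subgroup Y h f.range))
  · exact Or.inr hf.subsingleton

theorem IsPOrTrivial.of_surjective (hP : IsQuotientFittingClass P) {X Y : Type} [Group X] [Group Y]
    [Finite X] (f : X →* Y) (hf : Function.Surjective f) (h : IsPOrTrivial P X) :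
    IsPOrTrivial P Y := by
  rcases h with h | h
  · exact Or.inl (hP.iso _ _ ⟨QuotientGroup.quotientKerEquivOfSurjective f hf⟩
      (hP.quotient X h f.ker))
  · exact Or.inr hf.subsingleton

theorem IsPOrTrivial.comap (hP : IsQuotientFittingClass P) {X Y : Type} [Group X] [Group Y]
    [Finite Y] {N : Subgroup Y} (h : IsPOrTrivial P N) (f : X →* Y) (hf : Function.Injective f) :
    IsPOrTrivial P (N.comap f) :=
  h.of_injective hP (f.subgroupComap N)
    fun _ _ hab => Subtype.ext (hf (congrArg Subtype.val hab))

theorem le_Op_s9 {X : Type} [Group X] {R : Subgroup X} (hR : R.Normal) (h : IsPOrTrivial P R) :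
    R ≤ Op P X := by
  rcases h with h | h
  · intro x hx
    exact Subgroup.subset_closure (Set.mem_biUnion (x := R) ⟨hR, h⟩ hx)
  · rw [Subgroup.eq_bot_of_subsingleton R]
    exact bot_le

theorem isPOrTrivial_Op (hP : IsQuotientFittingClass P) (X : Type) [Group X] [Finite X] :
    IsPOrTrivial P (Op P X) := by
  rcases Set.eq_empty_or_nonempty {N : Subgroup X | N.Normal ∧ P N} with h | h
  · right
    have : Op P X = ⊥ := by simp [Op, genBy, h]
    rw [this]
    infer_instance
  · left
    obtain ⟨M, hM⟩ := (Set.toFinite {N : Subgroup X | N.Normal ∧ P N}).exists_maximal h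
    obtain ⟨hMn, hMP⟩ := hM.prop
    have : Op P X = M := by
      apply le_antisymm
      · refine (Subgroup.closure_le _).2 (Set.iUnion₂_subset fun N ⟨hNn, hNP⟩ => ?_)
        have hle : M ⊔ N ≤ M :=
          hM.le_of_ge ⟨Subgroup.sup_normal M N, hP.sup X M N hMP hNP⟩ le_sup_left
        exact (le_sup_right : N ≤ M ⊔ N).trans hle
      · exact le_Op_s9 hMn (Or.inl hMP)
    rw [this]
    exact hMP

theorem map_Op_le (hP : IsQuotientFittingClass P) {X : Type} [Group X] [Finite X] (e : X ≃* X) :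
    (Op P X).map e.toMonoidHom ≤ Op P X :=
  le_Op_s9 ((Op_normal P X).map _ e.surjective)
    ((isPOrTrivial_Op hP X).of_surjective hP _ (e.toMonoidHom.subgroupMap_surjective _))

theorem Op_eq_comap_of_injective (hP : IsQuotientFittingClass P) {X Y : Type} [Group X] [Group Y]
    [Finite Y] (f : X →* Y) (hf : Function.Injective f) (hr : f.range.Normal) :
    Op P X = (Op P Y).comap f := by
  have : Finite X := Finite.of_injective f hf
  apply le_antisymm
  · rw [← Subgroup.map_le_iff_le_comap]
    refine le_Op_s9 ⟨?_⟩
      ((isPOrTrivial_Op hP X).of_surjective hP _ (f.subgroupMap_surjective _))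
    rintro _ ⟨x, hx, rfl⟩ y
    let e := MonoidHom.ofInjective hf
    let φ : X ≃* X := e.trans ((MulAut.conjNormal y).trans e.symm)
    refine ⟨φ x, map_Op_le hP φ ⟨x, hx, rfl⟩, ?_⟩
    change ((e (e.symm (MulAut.conjNormal y (e x))) : f.range) : Y) = _
    rw [MulEquiv.apply_symm_apply, MulAut.conjNormal_apply]
    rfl
  · exact le_Op_s9 inferInstance ((isPOrTrivial_Op hP Y).comap hP f hf)

theorem isSubnormal_iff {G : Type} [Group G] {K : Subgroup G} :
    IsSubnormal K ↔ K.IsSubnormal := by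
  constructor
  · rintro ⟨n, c, h0, hn, hc⟩
    have h : ∀ i, (c i).IsSubnormal := by
      intro i
      induction i using Fin.reverseInduction with
      | last => rw [hn]; exact .top
      | cast i ih => exact .step _ _ (hc i).1 ih (hc i).2
    exact h0 ▸ h 0
  · intro h
    obtain ⟨n, f, hf, hN, h0, hn⟩ := Subgroup.IsSubnormal.isSubnormal_iff.1 h
    exact ⟨n, fun i => f i, h0, hn, fun i => ⟨hf (Nat.le_succ _), hN _⟩⟩

theorem Op_eq_subgroupOf_of_isSubnormal (hP : IsQuotientFittingClass P) {G : Type} [Group G]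
    [Finite G] {K : Subgroup G} (hK : K.IsSubnormal) : Op P K = (Op P G).subgroupOf K := by
  induction hK with
  | top =>
    refine Op_eq_comap_of_injective hP _ (Subgroup.subtype_injective _) ?_
    rw [Subgroup.range_subtype]
    infer_instance
  | step K L hle _ hN ih =>
    have h := Op_eq_comap_of_injective hP (Subgroup.inclusion hle)
      (Subgroup.inclusion_injective hle) (by rwa [Subgroup.inclusion_range])
    rw [h, ih]
    rfl

theorem nonempty_quotient_Op_mulEquiv (hP : IsQuotientFittingClass P) {G : Type} [Group G]
    [Finite G] {K : Subgroup G} (hK : K.IsSubnormal) :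
    Nonempty ((K ⧸ Op P K) ≃* K.map (QuotientGroup.mk' (Op P G))) := by
  let f := (QuotientGroup.mk' (Op P G)).subgroupMap K
  have h : Op P K = f.ker := by
    ext x
    rw [Op_eq_subgroupOf_of_isSubnormal hP hK, MonoidHom.mem_ker, Subtype.ext_iff]
    exact (QuotientGroup.eq_one_iff (N := Op P G) (x : G)).symm
  exact ⟨(QuotientGroup.quotientMulEquivOfEq h).trans
    (QuotientGroup.quotientKerEquivOfSurjective f (MonoidHom.subgroupMap_surjective _ _))⟩

theorem IsQuasisimple.of_mulEquiv {X Y : Type} [Group X] [Group Y] (e : X ≃* Y)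
    (h : IsQuasisimple X) : IsQuasisimple Y := by
  obtain ⟨h1, h2, a, b, hab⟩ := h
  have hc : (Subgroup.center X).map e = Subgroup.center Y := by
    ext y
    obtain ⟨x, rfl⟩ := e.surjective y
    rw [Subgroup.mem_center_iff, ← e.forall_congr_right]
    simp [Subgroup.mem_center_iff, ← map_mul]
  let q : (X ⧸ Subgroup.center X) ≃* (Y ⧸ Subgroup.center Y) := QuotientGroup.congr _ _ e hc
  refine ⟨?_, (MulEquiv.isSimpleGroup_congr q).1 h2, q a, q b, fun h => hab (q.injective ?_)⟩
  · have : Group.IsPerfect X := Group.isPerfect_def.2 h1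
    exact Group.isPerfect_def.1 (Group.IsPerfect.ofSurjective (f := e.toMonoidHom) e.surjective)
  · rw [map_mul, map_mul, h]

theorem eq_top_of_quotIsP {X : Type} [Group X] (h : Oup P X = ⊤) {N : Subgroup X}
    (hN : QuotIsP P N) : N = ⊤ :=
  top_le_iff.1 (h ▸ iInf₂_le N hN)

theorem range_le_of_Oup_eq_top (hP : IsQuotientFittingClass P) {X H : Type} [Group X] [Group H]
    [Finite H] (hX : Oup P X = ⊤) {A N : Subgroup H} [A.Normal] (hN : IsPOrTrivial P N)
    (hAN : A ⊔ N = ⊤) (f : X →* H) : f.range ≤ A := by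
  have hHA : IsPOrTrivial P (H ⧸ A) := by
    refine hN.of_surjective hP ((QuotientGroup.mk' A).comp N.subtype) ?_
    rw [← MonoidHom.range_eq_top, MonoidHom.range_comp, Subgroup.range_subtype,
      ← Subgroup.map_top_of_surjective _ (QuotientGroup.mk'_surjective A), ← hAN,
      Subgroup.map_sup, QuotientGroup.map_mk'_self, bot_sup_eq]
  let φ := (QuotientGroup.mk' A).comp f
  have hker : φ.ker = ⊤ := by
    rcases hHA.of_injective hP _ (QuotientGroup.kerLift_injective φ) with h | h
    · exact eq_top_of_quotIsP hX ⟨inferInstance, h⟩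
    · exact QuotientGroup.subgroup_eq_top_of_subsingleton _ h
  rintro _ ⟨x, rfl⟩
  have : x ∈ φ.ker := hker ▸ Subgroup.mem_top x
  exact (QuotientGroup.eq_one_iff (f x)).1 this

theorem sup_le_normalizer_of_Oup_eq_top (hP : IsQuotientFittingClass P) {G : Type} [Group G]
    [Finite G] {K N : Subgroup G} [N.Normal] (hN : IsPOrTrivial P N) (hO : Oup P K = ⊤)
    (hK : K.IsSubnormal) : K ⊔ N ≤ Subgroup.normalizer (K : Set G) := by
  suffices h : ∀ L : Subgroup G, L.IsSubnormal → K ≤ L →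
      L ⊓ (K ⊔ N) ≤ Subgroup.normalizer (K : Set G) → K ⊔ N ≤ Subgroup.normalizer (K : Set G) from
    h K hK le_rfl (inf_le_left.trans Subgroup.le_normalizer)
  intro L hL
  induction hL with
  | top => exact fun _ h => by rwa [top_inf_eq] at h
  | step H L hHL _ hHn ih =>
    intro hKH hH
    refine ih (hKH.trans hHL) ?_
    have hconj : ∀ g ∈ L ⊓ (K ⊔ N), ∀ k ∈ K, g * k * g⁻¹ ∈ K := by
      rintro g ⟨hgL, hg⟩ k hk
      let M := H ⊓ (K ⊔ N)
      have hKM : K ≤ M := le_inf hKH le_sup_left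
      have : (K.subgroupOf M).Normal := (Subgroup.normal_subgroupOf_iff_le_normalizer hKM).2 hH
      have hmem (x : K) : ((MulAut.conj g).toMonoidHom.comp K.subtype) x ∈ M :=
        ⟨(Subgroup.normal_subgroupOf_iff hHL).1 hHn x g (hKH x.2) hgL,
          ((K ⊔ N).mul_mem (mul_mem hg ((le_sup_left : K ≤ K ⊔ N) x.2)) (inv_mem hg))⟩
      have hNM : IsPOrTrivial P (N.subgroupOf M) :=
        hN.comap hP _ M.subtype_injective
      have hsup : K.subgroupOf M ⊔ N.subgroupOf M = ⊤ := by
        rw [eq_top_iff]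
        rintro ⟨x, hx⟩ -
        obtain ⟨a, ha, n, hn, rfl⟩ := Subgroup.mem_sup_of_normal_right.1 hx.2
        have hnM : n ∈ M := (Subgroup.mul_mem_cancel_left M (hKM ha)).1 hx
        have haK : (⟨a, hKM ha⟩ : M) ∈ K.subgroupOf M := ha
        have hnN : (⟨n, hnM⟩ : M) ∈ N.subgroupOf M := hn
        exact Subgroup.mul_mem_sup haK hnN
      exact range_le_of_Oup_eq_top hP hO hNM hsup
        (((MulAut.conj g).toMonoidHom.comp K.subtype).codRestrict M hmem) ⟨⟨k, hk⟩, rfl⟩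
    intro g hg
    refine Subgroup.mem_normalizer_iff.2 fun k => ⟨hconj g hg k, fun hk => ?_⟩
    have := hconj g⁻¹ (inv_mem hg) _ hk
    group at this
    simpa using this

theorem le_of_Oup_eq_top (hP : IsQuotientFittingClass P) {G : Type} [Group G] [Finite G]
    {K L N : Subgroup G} [N.Normal] (hN : IsPOrTrivial P N) (hK : K.IsSubnormal)
    (hKO : Oup P K = ⊤) (hLO : Oup P L = ⊤) (hLK : L ≤ K ⊔ N) : L ≤ K := by
  let H := K ⊔ N
  have hnormal : (K.subgroupOf H).Normal :=
    (Subgroup.normal_subgroupOf_iff_le_normalizer le_sup_left).2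
      (sup_le_normalizer_of_Oup_eq_top hP hN hKO hK)
  have hNH : IsPOrTrivial P (N.subgroupOf H) :=
    hN.comap hP _ H.subtype_injective
  have hsup : K.subgroupOf H ⊔ N.subgroupOf H = ⊤ := by
    rw [← Subgroup.subgroupOf_sup le_sup_left le_sup_right, Subgroup.subgroupOf_self]
  intro x hx
  exact range_le_of_Oup_eq_top hP hLO hNH hsup (Subgroup.inclusion hLK) ⟨⟨x, hx⟩, rfl⟩

theorem le_of_map_mk_eq (hP : IsQuotientFittingClass P) {G : Type} [Group G] [Finite G]
    {K L : Subgroup G} (hK : IsPComponent P K) (hL : IsPComponent P L)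
    (h : L.map (QuotientGroup.mk' (Op P G)) = K.map (QuotientGroup.mk' (Op P G))) : L ≤ K := by
  refine le_of_Oup_eq_top hP (isPOrTrivial_Op hP G) (isSubnormal_iff.1 hK.1) hK.2.2 hL.2.2 ?_
  rw [← QuotientGroup.ker_mk' (Op P G), ← Subgroup.comap_map_eq, ← h]
  exact Subgroup.le_comap_map _ _

theorem map_eq_top_of_isPerfect {X Y : Type} [Group X] [Group Y] [Group.IsPerfect Y]
    (f : X →* Y) (hf : Function.Surjective f) (M : Subgroup X) [hM : M.Normal]
    [Group.IsSolvable (X ⧸ M)] : M.map f = ⊤ := by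
  have := hM.map f hf
  let g : X ⧸ M →* Y ⧸ M.map f := QuotientGroup.map M (M.map f) f (Subgroup.le_comap_map f M)
  have hg : Function.Surjective g :=
    QuotientGroup.map_surjective_of_surjective _ _ _ ((QuotientGroup.mk_surjective).comp hf) _
  have hsol : Group.IsSolvable (Y ⧸ M.map f) := Group.isSolvable_of_surjective hg
  have : Group.IsPerfect (Y ⧸ M.map f) :=
    Group.IsPerfect.ofSurjective (QuotientGroup.mk'_surjective (M.map f))
  by_contra h
  have : Nontrivial (Y ⧸ M.map f) := QuotientGroup.nontrivial_iff.2 h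
  exact Group.IsPerfect.not_isSolvable (Y ⧸ M.map f) hsol

theorem exists_isPComponent_map_eq (hP : IsQuotientFittingClass P)
    (hsol : ∀ (X : Type) [Group X] [Finite X], P X → Group.IsSolvable X)
    {G : Type} [Group G] [Finite G] {C : Subgroup (G ⧸ Op P G)} (hC : IsComponent C) :
    ∃ K : Subgroup G, IsPComponent P K ∧ K.map (QuotientGroup.mk' (Op P G)) = C := by
  let π := QuotientGroup.mk' (Op P G)
  have hne : {K : Subgroup G | K.IsSubnormal ∧ K.map π = C}.Nonempty :=
    ⟨C.comap π, (isSubnormal_iff.1 hC.1).comap π,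
      Subgroup.map_comap_eq_self_of_surjective (QuotientGroup.mk'_surjective _) C⟩
  obtain ⟨K, hK⟩ := (Set.toFinite _).exists_minimal hne
  obtain ⟨hKs, rfl⟩ := hK.prop
  obtain ⟨e⟩ := nonempty_quotient_Op_mulEquiv hP hKs
  refine ⟨K, ⟨isSubnormal_iff.2 hKs, hC.2.of_mulEquiv e.symm, ?_⟩, rfl⟩
  have : Group.IsPerfect (K.map π) := Group.isPerfect_def.2 hC.2.1
  refine iInf₂_eq_top.2 fun M ⟨hM, hMP⟩ => ?_
  have := hsol _ hMP
  have htop := map_eq_top_of_isPerfect (π.subgroupMap K) (π.subgroupMap_surjective K) M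
  have hmap : (M.map K.subtype).map π = K.map π := by
    have := congrArg (Subgroup.map (K.map π).subtype) htop
    rw [Subgroup.map_map, ← MonoidHom.range_eq_map, Subgroup.range_subtype] at this
    rw [← this, Subgroup.map_map]
    rfl
  have hle : K ≤ M.map K.subtype :=
    hK.le_of_le ⟨hM.isSubnormal.trans' hKs, hmap⟩ (Subgroup.map_subtype_le M)
  rw [eq_top_iff]
  rintro x -
  obtain ⟨y, hy, hyx⟩ := hle x.2
  rwa [← Subtype.ext hyx]

end PClosure

theorem statement_9
    (P : (X : Type) → [inst : Group X] → Prop)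
    (hIso : ∀ (X Y : Type) [Group X] [Group Y] [Finite X], Nonempty (X ≃* Y) → P X → P Y)
    (hSubClosed : ∀ (X : Type) [Group X] [Finite X], P X → ∀ H : Subgroup X, P ↥H)
    (hQuotClosed : ∀ (X : Type) [Group X] [Finite X], P X → ∀ (N : Subgroup X) [N.Normal], P (X ⧸ N))
    (hInfClosed : ∀ (X : Type) [Group X] [Finite X] (M N : Subgroup X) [M.Normal] [N.Normal],
      P (X ⧸ M) → P (X ⧸ N) → P (X ⧸ (M ⊓ N)))
    (hJoinClosed : ∀ (X : Type) [Group X] [Finite X] (M N : Subgroup X) [M.Normal] [N.Normal],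
      P ↥M → P ↥N → P ↥(M ⊔ N))
    (G : Type) [Group G] [Finite G] :
    (∀ K : Subgroup G, IsPComponent P K →
      IsComponent (K.map (QuotientGroup.mk' (Op P G)))) ∧
    (∀ K L : Subgroup G, IsPComponent P K → IsPComponent P L →
      K.map (QuotientGroup.mk' (Op P G)) = L.map (QuotientGroup.mk' (Op P G)) → K = L) ∧
    ((∀ (X : Type) [Group X] [Finite X], P X → IsSolvable X) →
      ∀ C : Subgroup (G ⧸ Op P G), IsComponent C →
        ∃ K : Subgroup G, IsPComponent P K ∧ K.map (QuotientGroup.mk' (Op P G)) = C) := by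
  have hP : IsQuotientFittingClass P := ⟨hIso, hSubClosed, hQuotClosed, hJoinClosed⟩
  refine ⟨fun K hK => ?_, fun K L hK hL h => ?_, fun hsol C hC => ?_⟩
  · have hKs := isSubnormal_iff.1 hK.1
    obtain ⟨e⟩ := nonempty_quotient_Op_mulEquiv hP hKs
    exact ⟨isSubnormal_iff.2 hKs.quotient, hK.2.1.of_mulEquiv e⟩
  · exact le_antisymm (le_of_map_mk_eq hP hL hK h) (le_of_map_mk_eq hP hK hL h.symm)
  · exact exists_isPComponent_map_eq hP hsol hC

end PaperPF
end
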